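/- Let n ≥ 1 and let A denote the graded quotient ring ℚ[x,y]/(h_{n+1}, h_{n+2}) with its weighted grading (deg x = 1, deg y = 2). Then the ℚ-dimension of the degree-d graded piece of A equals ⌊d/2⌋ + 1 if 0 ≤ d ≤ n, equals n + 1 − ⌈d/2⌉ if n ≤ d ≤ 2n, and equals 0 if d > 2n. (This is the Hilbert function of the Grassmannian of lines in ℙ^{n+1}.) -/

import Mathlib

open MvPolynomial

/-- The complete homogeneous symmetric polynomial of degree `k` in two variables,
expressed in the elementary symmetric polynomials `x = X 0`, `y = X 1`. -/
noncomputable def h : ℕ → MvPolynomial (Fin 2) ℚ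
  | 0 => 1
  | 1 => X 0
  | (k + 2) => X 0 * h (k + 1) - X 1 * h k

/-- The ideal `(h_{n+1}, h_{n+2})` of `ℚ[x,y]`. -/
noncomputable def I (n : ℕ) : Ideal (MvPolynomial (Fin 2) ℚ) :=
  Ideal.span {h (n + 1), h (n + 2)}

/-- The degree-`d` graded piece of `ℚ[x,y]/(h_{n+1}, h_{n+2})` for the weighted grading
with `deg x = 1`, `deg y = 2`: the image of the weighted-degree-`d` homogeneous component
of `ℚ[x,y]` in the quotient. -/
noncomputable def gradedPiece (n d : ℕ) :
    Submodule ℚ (MvPolynomial (Fin 2) ℚ ⧸ I n) :=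
  Submodule.map (Ideal.Quotient.mkₐ ℚ (I n)).toLinearMap
    (weightedHomogeneousSubmodule ℚ ![1, 2] d)

lemma X_one_pow_mul_h_mem_I {n a b : ℕ} (hab : n + 1 ≤ a + b) :
    (X 1 ^ b * h a : MvPolynomial (Fin 2) ℚ) ∈ I n := by
  induction b generalizing a with
  | zero =>
    rw [pow_zero, one_mul]
    obtain ⟨k, rfl⟩ := Nat.exists_eq_add_of_le (show n + 1 ≤ a by omega)
    clear hab
    induction k using Nat.twoStepInduction with
    | zero => exact Ideal.subset_span (by simp)
    | one => exact Ideal.subset_span (by simp)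
    | more k ih₀ ih₁ =>
      exact sub_mem (Ideal.mul_mem_left _ _ ih₁) (Ideal.mul_mem_left _ _ ih₀)
  | succ b ih =>
    have key : (X 1 ^ (b + 1) * h a : MvPolynomial (Fin 2) ℚ) =
        X 0 * (X 1 ^ b * h (a + 1)) - X 1 ^ b * h (a + 2) := by
      rw [h]; ring
    rw [key]
    exact sub_mem (Ideal.mul_mem_left _ _ (ih (by omega))) (ih (by omega))

lemma h_isWeightedHomogeneous (k : ℕ) : (h k).IsWeightedHomogeneous ![1, 2] k := by
  induction k using Nat.twoStepInduction with
  | zero => exact isWeightedHomogeneous_one ℚ _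
  | one => exact isWeightedHomogeneous_X ℚ _ 0
  | more k ih₀ ih₁ =>
    have h₁ := (isWeightedHomogeneous_X ℚ ![1, 2] (0 : Fin 2)).mul ih₁
    have h₀ := (isWeightedHomogeneous_X ℚ ![1, 2] (1 : Fin 2)).mul ih₀
    refine (weightedHomogeneousSubmodule ℚ ![1, 2] (k + 2)).sub_mem ?_ ?_
    · have hd : (![1, 2] : Fin 2 → ℕ) 0 + (k + 1) = k + 2 := by simp; omega
      exact hd ▸ h₁
    · have hd : (![1, 2] : Fin 2 → ℕ) 1 + k = k + 2 := by simp; omega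
      exact hd ▸ h₀

/-- The span of the polynomials `y ^ b * h a` of weighted degree `d`. -/
noncomputable def hSpan (d : ℕ) : Submodule ℚ (MvPolynomial (Fin 2) ℚ) :=
  Submodule.span ℚ {p | ∃ a b : ℕ, a + 2 * b = d ∧ X 1 ^ b * h a = p}

lemma X_zero_mul_mem_hSpan {d : ℕ} {p : MvPolynomial (Fin 2) ℚ} (hp : p ∈ hSpan d) :
    X 0 * p ∈ hSpan (d + 1) := by
  induction hp using Submodule.span_induction with
  | zero => simp
  | add p q _ _ hp hq => rw [mul_add]; exact add_mem hp hq
  | smul c p _ hp => rw [mul_smul_comm]; exact Submodule.smul_mem _ _ hp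
  | mem p hp =>
    obtain ⟨a, b, hab, rfl⟩ := hp
    cases a with
    | zero =>
      refine Submodule.subset_span ⟨1, b, by omega, ?_⟩
      simp only [h]; ring
    | succ a =>
      have key : (X 0 * (X 1 ^ b * h (a + 1)) : MvPolynomial (Fin 2) ℚ) =
          X 1 ^ b * h (a + 2) + X 1 ^ (b + 1) * h a := by
        rw [h]; ring
      rw [key]
      exact add_mem (Submodule.subset_span ⟨_, _, by omega, rfl⟩)
        (Submodule.subset_span ⟨_, _, by omega, rfl⟩)

lemma X_one_mul_mem_hSpan {d : ℕ} {p : MvPolynomial (Fin 2) ℚ} (hp : p ∈ hSpan d) :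
    X 1 * p ∈ hSpan (d + 2) := by
  induction hp using Submodule.span_induction with
  | zero => simp
  | add p q _ _ hp hq => rw [mul_add]; exact add_mem hp hq
  | smul c p _ hp => rw [mul_smul_comm]; exact Submodule.smul_mem _ _ hp
  | mem p hp =>
    obtain ⟨a, b, hab, rfl⟩ := hp
    exact Submodule.subset_span ⟨a, b + 1, by omega, by ring⟩

lemma X_pow_mul_X_pow_mem_hSpan (a b : ℕ) :
    (X 0 ^ a * X 1 ^ b : MvPolynomial (Fin 2) ℚ) ∈ hSpan (a + 2 * b) := by
  induction a with
  | succ a ih =>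
    have := X_zero_mul_mem_hSpan ih
    rwa [← mul_assoc, ← pow_succ', show a + 2 * b + 1 = a + 1 + 2 * b by ring] at this
  | zero =>
    induction b with
    | zero => exact Submodule.subset_span ⟨0, 0, by simp [h]⟩
    | succ b ih =>
      have := X_one_mul_mem_hSpan ih
      rwa [mul_left_comm, ← pow_succ', show 0 + 2 * b + 2 = 0 + 2 * (b + 1) by ring] at this

lemma weightedHomogeneousSubmodule_eq_hSpan (d : ℕ) :
    weightedHomogeneousSubmodule ℚ ![1, 2] d = hSpan d := by
  apply le_antisymm
  · intro p hp
    rw [p.as_sum]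
    refine Submodule.sum_mem _ fun m hm => ?_
    have hd : Finsupp.weight ![1, 2] m = d := hp (mem_support_iff.mp hm)
    have hd' : m 0 + 2 * m 1 = d := by
      rw [← hd, Finsupp.weight_apply, Finsupp.sum_fintype _ _ (by simp)]
      simp [Fin.sum_univ_two, mul_comm]
    have hmon : monomial m (coeff m p) = coeff m p • (X 0 ^ m 0 * X 1 ^ m 1) := by
      rw [monomial_eq, Finsupp.prod_fintype _ _ (by simp)]
      simp [Fin.prod_univ_two, smul_eq_C_mul]
    rw [hmon, ← hd']
    exact Submodule.smul_mem _ _ (X_pow_mul_X_pow_mem_hSpan _ _)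
  · refine Submodule.span_le.mpr ?_
    rintro _ ⟨a, b, rfl, rfl⟩
    have hd : b • (![1, 2] : Fin 2 → ℕ) 1 + a = a + 2 * b := by simp; ring
    exact hd ▸ ((isWeightedHomogeneous_X ℚ ![1, 2] (1 : Fin 2)).pow b).mul
      (h_isWeightedHomogeneous a)

/-- The substitution `x = u + v`, `y = u * v` followed by multiplication by the Vandermonde
factor `u - v`. -/
noncomputable def antisymmetrization : MvPolynomial (Fin 2) ℚ →ₗ[ℚ] MvPolynomial (Fin 2) ℚ :=
  LinearMap.mulLeft ℚ (X 0 - X 1) ∘ₗ (aeval ![X 0 + X 1, X 0 * X 1]).toLinearMap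

lemma antisymmetrization_mul (p q : MvPolynomial (Fin 2) ℚ) :
    antisymmetrization (p * q) = aeval ![X 0 + X 1, X 0 * X 1] p * antisymmetrization q := by
  simp [antisymmetrization]; ring

lemma antisymmetrization_h (k : ℕ) : antisymmetrization (h k) = X 0 ^ (k + 1) - X 1 ^ (k + 1) := by
  induction k using Nat.twoStepInduction with
  | zero => simp [antisymmetrization, h]
  | one => simp [antisymmetrization, h]; ring
  | more k ih₀ ih₁ =>
    rw [h, map_sub, antisymmetrization_mul, antisymmetrization_mul, ih₀, ih₁]
    simp; ring

lemma coeff_mul_X_pow_eq_zero {σ R : Type*} [CommSemiring R] (p : MvPolynomial σ R) {i : σ}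
    {k : ℕ} {m : σ →₀ ℕ} (hm : m i < k) : coeff m (p * X i ^ k) = 0 := by
  classical
  rw [X_pow_eq_monomial, coeff_mul_monomial', if_neg]
  exact fun hle => by simpa using (hle i).trans_lt hm

lemma coeff_antisymmetrization_eq_zero_of_mem_I {n : ℕ} {p : MvPolynomial (Fin 2) ℚ} (hp : p ∈ I n)
    {m : Fin 2 →₀ ℕ} (hm : ∀ i, m i < n + 2) : coeff m (antisymmetrization p) = 0 := by
  obtain ⟨a, b, rfl⟩ := Ideal.mem_span_pair.mp hp
  have hm' (i : Fin 2) : m i < n + 2 + 1 := (hm i).trans (Nat.lt_succ_self _)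
  simp only [map_add, antisymmetrization_mul, antisymmetrization_h, mul_sub, coeff_add, coeff_sub]
  simp only [coeff_mul_X_pow_eq_zero _ (hm _), coeff_mul_X_pow_eq_zero _ (hm' _), sub_zero,
    add_zero]

lemma coeff_X_pow_mul_X_pow (i j k l : ℕ) :
    coeff (Finsupp.single 0 i + Finsupp.single 1 j)
      (X 0 ^ k * X 1 ^ l : MvPolynomial (Fin 2) ℚ) = if k = i ∧ l = j then 1 else 0 := by
  rw [X_pow_eq_monomial, X_pow_eq_monomial, monomial_mul, coeff_monomial, one_mul]
  congr 1
  simp [Finsupp.ext_iff, Fin.forall_fin_two]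

lemma coeff_antisymmetrization_X_pow_mul_h {d b c : ℕ} (hb : 2 * b ≤ d) (hc : 2 * c ≤ d) :
    coeff (Finsupp.single 0 (d - c + 1) + Finsupp.single 1 c)
      (antisymmetrization (X 1 ^ b * h (d - 2 * b))) = if b = c then 1 else 0 := by
  have key : antisymmetrization (X 1 ^ b * h (d - 2 * b)) =
      X 0 ^ (d - b + 1) * X 1 ^ b - X 0 ^ b * X 1 ^ (d - b + 1) := by
    rw [antisymmetrization_mul, antisymmetrization_h, show d - b + 1 = b + (d - 2 * b + 1) by omega]
    simp; ring
  rw [key, coeff_sub, coeff_X_pow_mul_X_pow, coeff_X_pow_mul_X_pow,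
    if_neg (show ¬(b = d - c + 1 ∧ d - b + 1 = c) by omega), sub_zero]
  congr 1
  apply propext
  omega

lemma finrank_gradedPiece (n d : ℕ) :
    Module.finrank ℚ (gradedPiece n d) = d / 2 + 1 - (d - n) := by
  let v : Finset.Icc (d - n) (d / 2) → MvPolynomial (Fin 2) ℚ ⧸ I n :=
    fun b => Ideal.Quotient.mkₐ ℚ (I n) (X 1 ^ (b : ℕ) * h (d - 2 * b))
  have hspan : gradedPiece n d = Submodule.span ℚ (Set.range v) := by
    rw [gradedPiece, weightedHomogeneousSubmodule_eq_hSpan, hSpan, Submodule.map_span]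
    apply le_antisymm <;> refine Submodule.span_le.mpr ?_
    · rintro _ ⟨_, ⟨a, b, rfl, rfl⟩, rfl⟩
      by_cases hab : n + 1 ≤ a + b
      · have : Ideal.Quotient.mkₐ ℚ (I n) (X 1 ^ b * h a) = 0 :=
          Ideal.Quotient.eq_zero_iff_mem.mpr (X_one_pow_mul_h_mem_I hab)
        simp [this]
      · refine Submodule.subset_span ⟨⟨b, Finset.mem_Icc.mpr (by omega)⟩, ?_⟩
        simp [v]
    · rintro _ ⟨⟨b, hb⟩, rfl⟩
      have := Finset.mem_Icc.mp hb
      exact Submodule.subset_span ⟨_, ⟨d - 2 * b, b, by omega, rfl⟩, rfl⟩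
  have hindep : LinearIndependent ℚ v := by
    rw [Fintype.linearIndependent_iff]
    rintro g hg ⟨c, hc⟩
    have hmem : ∑ b, g b • (X 1 ^ (b : ℕ) * h (d - 2 * b)) ∈ I n := by
      rw [← Ideal.Quotient.eq_zero_iff_mem, ← hg, ← Ideal.Quotient.mkₐ_eq_mk ℚ, map_sum]
      simp only [map_smul, v]
    have hc' := Finset.mem_Icc.mp hc
    have hcd : 2 * c ≤ d := by omega
    have hzero := coeff_antisymmetrization_eq_zero_of_mem_I hmem
      (m := Finsupp.single 0 (d - c + 1) + Finsupp.single 1 c)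
      (by simp only [Fin.forall_fin_two]; constructor <;> simp <;> omega)
    rw [map_sum, coeff_sum, Finset.sum_eq_single ⟨c, hc⟩] at hzero
    · rwa [map_smul, coeff_smul, coeff_antisymmetrization_X_pow_mul_h hcd hcd, if_pos rfl,
        smul_eq_mul, mul_one] at hzero
    · rintro ⟨b, hb⟩ - hbc
      have hb' := Finset.mem_Icc.mp hb
      have hbd : 2 * b ≤ d := by omega
      rw [map_smul, coeff_smul, coeff_antisymmetrization_X_pow_mul_h hbd hcd,
        if_neg (by simpa using hbc), smul_zero]
    · simp
  rw [hspan, finrank_span_eq_card hindep]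
  simp

/-- Hilbert function of the Grassmannian of lines in `ℙ^{n+1}`. -/
theorem stmt4 (n : ℕ) (hn : 1 ≤ n) (d : ℕ) :
    (d ≤ n → Module.finrank ℚ (gradedPiece n d) = d / 2 + 1) ∧
    (n ≤ d → d ≤ 2 * n → Module.finrank ℚ (gradedPiece n d) = n + 1 - (d + 1) / 2) ∧
    (2 * n < d → Module.finrank ℚ (gradedPiece n d) = 0) := by
  rw [finrank_gradedPiece]
  omega
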